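/- arXiv:0706.1634 — 8 statements merged into one kernel-verified Lean document; each statement's English description precedes it below -/
import Mathlib

section
/- Suppose ω ∈ ℝ and v ∈ ℂⁿ with v^*·v = 1 satisfy M(iω)·v = 0. Set z := e^{−i·h_m·ω} and φ_k := h_k·ω for k = 0, …, m−1 (so φ_0 = 0). Then |z| = 1, the quadratic matrix equation z²·A_m·(v·v^*) + z·Σ_{k=0}^{m−1}(e^{−i·φ_k}·A_k·(v·v^*) + e^{i·φ_k}·(v·v^*)·A_kᵀ) + (v·v^*)·A_mᵀ = 0 holds, and i·ω = v^*·(z·A_m + Σ_{k=0}^{m−1} e^{−i·φ_k}·A_k)·v. -/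
open Matrix Complex
open scoped ComplexConjugate

/-- The characteristic matrix `M(s) = -s I + ∑ₖ Aₖ e^{-hₖ s}` of the DDE
`ẋ(t) = ∑ₖ Aₖ x(t - hₖ)`, with real matrices `Aₖ` regarded as complex matrices. -/
noncomputable def charM (n m : ℕ) (A : Fin (m+1) → Matrix (Fin n) (Fin n) ℝ)
    (h : Fin (m+1) → ℝ) (s : ℂ) : Matrix (Fin n) (Fin n) ℂ :=
  (-s) • (1 : Matrix (Fin n) (Fin n) ℂ) +
    ∑ k : Fin (m+1), Complex.exp (-(h k : ℂ) * s) • ((A k).map Complex.ofReal)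

/-- The operator `L(X, s) = M(s) X + X M(s)^*`. -/
noncomputable def Lop (n m : ℕ) (A : Fin (m+1) → Matrix (Fin n) (Fin n) ℝ)
    (h : Fin (m+1) → ℝ) (X : Matrix (Fin n) (Fin n) ℂ) (s : ℂ) :
    Matrix (Fin n) (Fin n) ℂ :=
  charM n m A h s * X + X * (charM n m A h s)ᴴ

/-- Forward direction of Theorem 3 (free delays): if `M(iω)v = 0` with `v^*v = 1`,
then with `z = e^{-i hₘ ω}` and `φₖ = hₖ ω`, `|z| = 1`, the quadratic matrix
equation holds, and `iω = v^*(z Aₘ + ∑ₖ e^{-iφₖ} Aₖ)v`. -/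
theorem statement3 (n m : ℕ) (hn : 0 < n) (hm : 0 < m)
    (A : Fin (m+1) → Matrix (Fin n) (Fin n) ℝ) (h : Fin (m+1) → ℝ) (h0 : h 0 = 0)
    (ω : ℝ) (v : Fin n → ℂ) (hv : star v ⬝ᵥ v = 1)
    (heig : (charM n m A h (Complex.I * ω)).mulVec v = 0)
    (z : ℂ) (hz : z = Complex.exp (-(Complex.I * (h (Fin.last m) : ℂ) * ω)))
    (φ : Fin m → ℝ) (hφ : ∀ k : Fin m, φ k = h k.castSucc * ω) :
    ‖z‖ = 1 ∧
    z ^ 2 • ((A (Fin.last m)).map Complex.ofReal * vecMulVec v (star v)) +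
      z • (∑ k : Fin m,
        (Complex.exp (-(Complex.I * (φ k : ℂ))) •
            ((A k.castSucc).map Complex.ofReal * vecMulVec v (star v)) +
          Complex.exp (Complex.I * (φ k : ℂ)) •
            (vecMulVec v (star v) * ((A k.castSucc).map Complex.ofReal)ᵀ))) +
      vecMulVec v (star v) * ((A (Fin.last m)).map Complex.ofReal)ᵀ = 0 ∧
    Complex.I * ω = star v ⬝ᵥ ((z • (A (Fin.last m)).map Complex.ofReal +
      ∑ k : Fin m, Complex.exp (-(Complex.I * (φ k : ℂ))) •
        (A k.castSucc).map Complex.ofReal).mulVec v) := by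
  have hBv : (z • (A (Fin.last m)).map Complex.ofReal +
      ∑ k : Fin m, Complex.exp (-(Complex.I * (φ k : ℂ))) •
        (A k.castSucc).map Complex.ofReal).mulVec v = (Complex.I * ω) • v := by
    have hsum : charM n m A h (Complex.I * ω) = -((Complex.I * ω) • 1) +
        (z • (A (Fin.last m)).map Complex.ofReal +
          ∑ k : Fin m, Complex.exp (-(Complex.I * (φ k : ℂ))) •
            (A k.castSucc).map Complex.ofReal) := by
      rw [charM, Fin.sum_univ_castSucc, add_comm (∑ k : Fin m, _), neg_smul, hz]
      congr 3
      · congr 2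
        ring
      · refine funext fun k => ?_
        congr 2
        rw [hφ]
        push_cast
        ring
    rw [hsum, add_mulVec, neg_mulVec, smul_mulVec, one_mulVec] at heig
    exact (neg_add_eq_zero.mp heig).symm
  have hnorm : ‖z‖ = 1 := by
    rw [hz, Complex.norm_exp]
    simp
  have hzz : z * star z = 1 := by
    rw [Complex.star_def, Complex.mul_conj, Complex.normSq_eq_norm_sq, hnorm]
    simp
  refine ⟨hnorm, ?_, ?_⟩
  · set B := z • (A (Fin.last m)).map Complex.ofReal +
      ∑ k : Fin m, Complex.exp (-(Complex.I * (φ k : ℂ))) •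
        (A k.castSucc).map Complex.ofReal with hB
    have hBH : Bᴴ = star z • ((A (Fin.last m)).map Complex.ofReal)ᵀ +
        ∑ k : Fin m, Complex.exp (Complex.I * (φ k : ℂ)) •
          ((A k.castSucc).map Complex.ofReal)ᵀ := by
      have hreal (C : Matrix (Fin n) (Fin n) ℝ) :
          (C.map Complex.ofReal)ᴴ = (C.map Complex.ofReal)ᵀ := by
        ext i j
        simp
      rw [hB, conjTranspose_add, conjTranspose_smul, conjTranspose_sum, hreal]
      congr 1
      refine Finset.sum_congr rfl fun k _ => ?_
      rw [conjTranspose_smul, hreal, Complex.star_def, ← Complex.exp_conj]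
      simp
    have hBX : B * vecMulVec v (star v) = (Complex.I * ω) • vecMulVec v (star v) := by
      rw [mul_vecMulVec, hBv, smul_vecMulVec]
    have hXB : vecMulVec v (star v) * Bᴴ = -((Complex.I * ω) • vecMulVec v (star v)) := by
      rw [vecMulVec_mul, ← star_mulVec, hBv, star_smul, vecMulVec_smul]
      simp
    have key : z • (B * vecMulVec v (star v) + vecMulVec v (star v) * Bᴴ) = 0 := by
      rw [hBX, hXB, add_neg_cancel, smul_zero]
    rw [← key, hBH, hB]
    simp only [add_mul, mul_add, Finset.sum_mul, Finset.mul_sum, smul_mul_assoc,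
      mul_smul_comm, smul_add, smul_smul, hzz, one_smul, Finset.sum_add_distrib, sq]
    abel
  · rw [hBv, dotProduct_smul, hv, smul_eq_mul, mul_one]
end

section
/- Let φ_1, …, φ_{m−1} ∈ ℝ with the convention φ_0 = 0, let z ∈ ℂ with |z| = 1, and let v ∈ ℂⁿ with v^*·v = 1 satisfy the quadratic matrix equation z²·A_m·(v·v^*) + z·Σ_{k=0}^{m−1}(e^{−i·φ_k}·A_k·(v·v^*) + e^{i·φ_k}·(v·v^*)·A_kᵀ) + (v·v^*)·A_mᵀ = 0. Let ω ∈ ℝ with ω ≠ 0 be such that i·ω = v^*·(z·A_m + Σ_{k=0}^{m−1} e^{−i·φ_k}·A_k)·v. For any integers p_1, …, p_m define the delays h_k := (φ_k + 2·p_k·π)/ω for k = 1, …, m−1 and h_m := (−Arg z + 2·p_m·π)/ω, where Arg denotes the principal argument. Then with these delays M(iω)·v = 0; that is, iω is a purely imaginary eigenvalue of the delay-differential equation. -/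
open Matrix Complex
open scoped ComplexConjugate

/-- A unit vector `v` whose projector satisfies `N v v^* + v v^* N^* = 0` is an eigenvector of `N`
for its Rayleigh quotient. -/
theorem mulVec_eq_rayleigh_smul {n : Type*} [Fintype n] (N : Matrix n n ℂ) (v : n → ℂ)
    (hv : star v ⬝ᵥ v = 1) (hN : N * vecMulVec v (star v) + vecMulVec v (star v) * Nᴴ = 0)
    (ω : ℝ) (hω : Complex.I * ω = star v ⬝ᵥ N.mulVec v) :
    N.mulVec v = (Complex.I * ω) • v := by
  have hadj : star v ⬝ᵥ Nᴴ.mulVec v = -(Complex.I * ω) := by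
    have h1 : star (Complex.I * (ω : ℂ)) = star (star v ⬝ᵥ N.mulVec v) := by rw [hω]
    rw [← star_dotProduct_star, star_star, star_mulVec] at h1
    rw [dotProduct_mulVec, dotProduct_comm]
    simpa [dotProduct_comm, vecMul_conjTranspose, mulVec_conjTranspose, dotProduct_mulVec]
      using h1.symm
  have h2 := congrArg (fun X => X.mulVec v) hN
  simp only [add_mulVec, ← mulVec_mulVec, vecMulVec_mulVec, zero_mulVec, hv, hadj] at h2
  simpa only [MulOpposite.op_one, one_smul, op_smul_eq_smul, neg_smul, add_neg_eq_zero] using h2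

theorem exp_neg_delay_mul {ω : ℝ} (hω : ω ≠ 0) (θ : ℝ) (p : ℤ) :
    Complex.exp (-(((θ + 2 * (p : ℝ) * Real.pi) / ω : ℝ) : ℂ) * (Complex.I * ω)) =
      Complex.exp (-(Complex.I * θ)) := by
  have hω' : (ω : ℂ) ≠ 0 := Complex.ofReal_ne_zero.mpr hω
  rw [Complex.exp_eq_exp_iff_exists_int]
  refine ⟨-p, ?_⟩
  push_cast
  field_simp
  ring

/-- Converse direction of Theorem 3 (free delays): given a unit-circle solution
`(z, v)` of the quadratic matrix equation and a nonzero real `ω` with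
`iω = v^*(z Aₘ + ∑ₖ e^{-iφₖ} Aₖ)v`, the delays
`hₖ = (φₖ + 2 pₖ π)/ω` (k = 1,…,m−1) and `hₘ = (−Arg z + 2 pₘ π)/ω`
give `M(iω) v = 0`. -/
theorem statement4 (n m : ℕ) (hn : 0 < n) (hm : 0 < m)
    (A : Fin (m+1) → Matrix (Fin n) (Fin n) ℝ)
    (φ : Fin m → ℝ) (hφ0 : φ ⟨0, hm⟩ = 0)
    (z : ℂ) (hz : ‖z‖ = 1)
    (v : Fin n → ℂ) (hv : star v ⬝ᵥ v = 1)
    (hquad :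
      z ^ 2 • ((A (Fin.last m)).map Complex.ofReal * vecMulVec v (star v)) +
        z • (∑ k : Fin m,
          (Complex.exp (-(Complex.I * (φ k : ℂ))) •
              ((A k.castSucc).map Complex.ofReal * vecMulVec v (star v)) +
            Complex.exp (Complex.I * (φ k : ℂ)) •
              (vecMulVec v (star v) * ((A k.castSucc).map Complex.ofReal)ᵀ))) +
        vecMulVec v (star v) * ((A (Fin.last m)).map Complex.ofReal)ᵀ = 0)
    (ω : ℝ) (hω : ω ≠ 0)
    (homega : Complex.I * ω = star v ⬝ᵥ ((z • (A (Fin.last m)).map Complex.ofReal +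
      ∑ k : Fin m, Complex.exp (-(Complex.I * (φ k : ℂ))) •
        (A k.castSucc).map Complex.ofReal).mulVec v))
    (p : Fin (m+1) → ℤ) (h : Fin (m+1) → ℝ) (h0 : h 0 = 0)
    (hdel : ∀ k : Fin m, (k : ℕ) ≠ 0 →
      h k.castSucc = (φ k + 2 * (p k.castSucc : ℝ) * Real.pi) / ω)
    (hdelm : h (Fin.last m) =
      (-(Complex.arg z) + 2 * (p (Fin.last m) : ℝ) * Real.pi) / ω) :
    (charM n m A h (Complex.I * ω)).mulVec v = 0 := by
  set N : Matrix (Fin n) (Fin n) ℂ := z • (A (Fin.last m)).map Complex.ofReal +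
    ∑ k : Fin m, Complex.exp (-(Complex.I * (φ k : ℂ))) •
      (A k.castSucc).map Complex.ofReal with hNdef
  have hz0 : z ≠ 0 := norm_ne_zero_iff.mp (by rw [hz]; exact one_ne_zero)
  have hzz : z * conj z = 1 := by rw [Complex.mul_conj']; simp [hz]
  have hreal (B : Matrix (Fin n) (Fin n) ℝ) :
      (B.map Complex.ofReal)ᴴ = (B.map Complex.ofReal)ᵀ := by
    ext i j; simp
  have hexp (t : ℝ) : conj (Complex.exp (-(Complex.I * (t : ℂ)))) =
      Complex.exp (Complex.I * t) := by
    rw [← Complex.exp_conj]; simp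
  have hN : N * vecMulVec v (star v) + vecMulVec v (star v) * Nᴴ = 0 := by
    refine (smul_eq_zero_iff_right hz0).mp ?_
    rw [← hquad, hNdef]
    simp only [conjTranspose_add, conjTranspose_smul, conjTranspose_sum, hreal, add_mul, mul_add,
      Finset.sum_mul, Finset.mul_sum, smul_mul_assoc, mul_smul_comm, smul_add, smul_smul,
      Finset.sum_add_distrib, ← starRingEnd_apply, hexp, hzz, one_smul, pow_two]
    abel
  have hM : charM n m A h (Complex.I * ω) = (-(Complex.I * ω)) • 1 + N := by
    have hlast : Complex.exp (-(h (Fin.last m) : ℂ) * (Complex.I * ω)) = z := by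
      rw [hdelm, exp_neg_delay_mul hω]
      have := Complex.norm_mul_exp_arg_mul_I z
      rw [hz, Complex.ofReal_one, one_mul] at this
      rw [Complex.ofReal_neg, mul_neg, neg_neg, mul_comm, this]
    have hk (k : Fin m) : Complex.exp (-(h k.castSucc : ℂ) * (Complex.I * ω)) =
        Complex.exp (-(Complex.I * (φ k : ℂ))) := by
      by_cases hk0 : (k : ℕ) = 0
      · obtain rfl : k = ⟨0, hm⟩ := Fin.ext hk0
        have : (⟨0, hm⟩ : Fin m).castSucc = 0 := rfl
        rw [this, h0, hφ0]
        simp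
      · rw [hdel k hk0, exp_neg_delay_mul hω]
    rw [charM, Fin.sum_univ_castSucc, hlast, hNdef]
    simp only [hk]
    rw [add_comm (∑ k : Fin m, _)]
  rw [hM, add_mulVec, smul_mulVec, one_mulVec,
    mulVec_eq_rayleigh_smul N v hv hN ω homega, neg_smul, neg_add_cancel]
end

section
/- Let φ_1, …, φ_{m−1} ∈ ℝ with φ_0 = 0, let z ∈ ℂ with |z| = 1, and let v ∈ ℂⁿ with v^*·v = 1 satisfy the quadratic matrix equation z²·A_m·(v·v^*) + z·Σ_{k=0}^{m−1}(e^{−i·φ_k}·A_k·(v·v^*) + e^{i·φ_k}·(v·v^*)·A_kᵀ) + (v·v^*)·A_mᵀ = 0. Then the complex number v^*·(z·A_m + Σ_{k=0}^{m−1} e^{−i·φ_k}·A_k)·v is purely imaginary (its real part is zero); equivalently, ω := −i·v^*·(z·A_m + Σ_{k=0}^{m−1} e^{−i·φ_k}·A_k)·v is a real number. -/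
open Matrix Complex
open scoped ComplexConjugate

/-- For a unit vector `v`, `v^*(B v v^*)v = v^* B v`. -/
lemma star_dotProduct_mul_vecMulVec_mulVec {n : ℕ} {v : Fin n → ℂ} (hv : star v ⬝ᵥ v = 1)
    (B : Matrix (Fin n) (Fin n) ℂ) :
    star v ⬝ᵥ ((B * vecMulVec v (star v)) *ᵥ v) = star v ⬝ᵥ (B *ᵥ v) := by
  rw [← mulVec_mulVec, vecMulVec_mulVec, hv]
  simp

/-- For a unit vector `v` and a real matrix `B`, `v^*(v v^* Bᵀ)v` is the conjugate of `v^* B v`. -/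
lemma star_dotProduct_vecMulVec_mul_transpose_mulVec {n : ℕ} {v : Fin n → ℂ}
    (hv : star v ⬝ᵥ v = 1) (B : Matrix (Fin n) (Fin n) ℝ) :
    star v ⬝ᵥ ((vecMulVec v (star v) * (B.map Complex.ofReal)ᵀ) *ᵥ v) =
      conj (star v ⬝ᵥ (B.map Complex.ofReal *ᵥ v)) := by
  have hB : (B.map Complex.ofReal)ᵀ = (B.map Complex.ofReal)ᴴ := by
    ext i j
    simp [conjTranspose_apply]
  rw [← mulVec_mulVec, vecMulVec_mulVec, dotProduct_smul, hv, hB, starRingEnd_apply,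
    ← star_dotProduct, star_mulVec, ← dotProduct_mulVec]
  simp

/-- If `(z, v)` with `|z| = 1`, `v^*v = 1` solves the quadratic matrix equation,
then `v^*(z Aₘ + ∑ₖ e^{-iφₖ} Aₖ)v` is purely imaginary (its real part is zero). -/
theorem statement5 (n m : ℕ) (hn : 0 < n) (hm : 0 < m)
    (A : Fin (m+1) → Matrix (Fin n) (Fin n) ℝ)
    (φ : Fin m → ℝ) (hφ0 : φ ⟨0, hm⟩ = 0)
    (z : ℂ) (hz : ‖z‖ = 1)
    (v : Fin n → ℂ) (hv : star v ⬝ᵥ v = 1)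
    (hquad :
      z ^ 2 • ((A (Fin.last m)).map Complex.ofReal * vecMulVec v (star v)) +
        z • (∑ k : Fin m,
          (Complex.exp (-(Complex.I * (φ k : ℂ))) •
              ((A k.castSucc).map Complex.ofReal * vecMulVec v (star v)) +
            Complex.exp (Complex.I * (φ k : ℂ)) •
              (vecMulVec v (star v) * ((A k.castSucc).map Complex.ofReal)ᵀ))) +
        vecMulVec v (star v) * ((A (Fin.last m)).map Complex.ofReal)ᵀ = 0) :
    (star v ⬝ᵥ ((z • (A (Fin.last m)).map Complex.ofReal +
      ∑ k : Fin m, Complex.exp (-(Complex.I * (φ k : ℂ))) •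
        (A k.castSucc).map Complex.ofReal).mulVec v)).re = 0 := by
  have hzz : z * conj z = 1 := by
    rw [Complex.mul_conj, Complex.normSq_eq_norm_sq, hz]
    simp
  have hz0 : z ≠ 0 := left_ne_zero_of_mul_eq_one hzz
  have hexp (k : Fin m) : Complex.exp (Complex.I * (φ k : ℂ)) =
      conj (Complex.exp (-(Complex.I * (φ k : ℂ)))) := by
    rw [← Complex.exp_conj]
    simp
  have h := congrArg (fun M : Matrix (Fin n) (Fin n) ℂ => star v ⬝ᵥ (M *ᵥ v)) hquad
  simp only [add_mulVec, smul_mulVec, sum_mulVec, dotProduct_add, dotProduct_smul,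
    dotProduct_sum, star_dotProduct_mul_vecMulVec_mulVec hv,
    star_dotProduct_vecMulVec_mul_transpose_mulVec hv, zero_mulVec, dotProduct_zero,
    smul_eq_mul, hexp, Finset.sum_add_distrib] at h
  simp only [add_mulVec, smul_mulVec, sum_mulVec, dotProduct_add, dotProduct_smul,
    dotProduct_sum, smul_eq_mul]
  set w := z * (star v ⬝ᵥ ((A (Fin.last m)).map Complex.ofReal *ᵥ v)) +
    ∑ k : Fin m, Complex.exp (-(Complex.I * (φ k : ℂ))) *
      (star v ⬝ᵥ ((A k.castSucc).map Complex.ofReal *ᵥ v)) with hw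
  have hsum : w + conj w = 0 := by
    refine (mul_eq_zero.mp ?_).resolve_left hz0
    simp only [hw, map_add, map_mul, map_sum]
    linear_combination h + conj (star v ⬝ᵥ ((A (Fin.last m)).map Complex.ofReal *ᵥ v)) * hzz
  rw [Complex.add_conj] at hsum
  have := congrArg Complex.re hsum
  simpa using this
end

section
/- Let h, ω ∈ ℝ and v ∈ ℂⁿ with v^*·v = 1 satisfy (−iω·I_n + Σ_{k=0}^m A_k·e^{−i·n_k·h·ω})·v = 0. Set z := e^{−i·h·ω}. Then |z| = 1, Σ_{k=0}^m (z^{n_k}·A_k·(v·v^*) + z^{−n_k}·(v·v^*)·A_kᵀ) = 0, and i·ω = v^*·(Σ_{k=0}^m z^{n_k}·A_k)·v. -/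
open Matrix Complex
open scoped ComplexConjugate

/-- Forward direction of the commensurate-delay theorem: if
`(−iω I + ∑ₖ Aₖ e^{−i nₖ h ω}) v = 0` with `v^*v = 1`, then with
`z = e^{−i h ω}` one has `|z| = 1`,
`∑ₖ (z^{nₖ} Aₖ v v^* + z^{−nₖ} v v^* Aₖᵀ) = 0` and
`iω = v^* (∑ₖ z^{nₖ} Aₖ) v`. -/
theorem statement10 (n m : ℕ) (hn : 0 < n) (hm : 0 < m)
    (A : Fin (m+1) → Matrix (Fin n) (Fin n) ℝ)
    (nk : Fin (m+1) → ℕ) (hnk0 : nk 0 = 0)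
    (h ω : ℝ) (v : Fin n → ℂ) (hv : star v ⬝ᵥ v = 1)
    (heig : ((-(Complex.I * (ω : ℂ))) • (1 : Matrix (Fin n) (Fin n) ℂ) +
      ∑ k : Fin (m+1), Complex.exp (-(Complex.I * (nk k : ℂ) * (h : ℂ) * (ω : ℂ))) •
        ((A k).map Complex.ofReal)).mulVec v = 0)
    (z : ℂ) (hz : z = Complex.exp (-(Complex.I * (h : ℂ) * (ω : ℂ)))) :
    ‖z‖ = 1 ∧
    (∑ k : Fin (m+1),
      (z ^ (nk k) • ((A k).map Complex.ofReal * vecMulVec v (star v)) +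
        z ^ (-(nk k : ℤ)) • (vecMulVec v (star v) * ((A k).map Complex.ofReal)ᵀ))) = 0 ∧
    Complex.I * (ω : ℂ) =
      star v ⬝ᵥ ((∑ k : Fin (m+1), z ^ (nk k) • (A k).map Complex.ofReal).mulVec v) := by
  have hnorm : ‖z‖ = 1 := by
    rw [hz, Complex.norm_exp]
    simp
  have hpow : ∀ k, Complex.exp (-(Complex.I * (nk k : ℂ) * (h : ℂ) * (ω : ℂ))) = z ^ nk k := by
    intro k
    rw [hz, ← Complex.exp_nat_mul]
    congr 1
    ring
  have hstar : star z = z⁻¹ := by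
    rw [Complex.inv_eq_conj hnorm, starRingEnd_apply]
  simp only [hpow] at heig
  set S : Matrix (Fin n) (Fin n) ℂ :=
    ∑ k : Fin (m+1), z ^ nk k • (A k).map Complex.ofReal with hS
  have hSv : S *ᵥ v = (Complex.I * (ω : ℂ)) • v := by
    rw [add_mulVec, smul_mulVec, one_mulVec, neg_smul, neg_add_eq_zero] at heig
    exact heig.symm
  have hSH : Sᴴ = ∑ k : Fin (m+1), z ^ (-(nk k : ℤ)) • ((A k).map Complex.ofReal)ᵀ := by
    rw [hS, conjTranspose_sum]
    refine Finset.sum_congr rfl fun k _ => ?_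
    rw [conjTranspose_smul, star_pow, hstar, _root_.zpow_neg, _root_.zpow_natCast, inv_pow]
    congr 1
    ext i j
    simp
  have hP : S * vecMulVec v (star v) = (Complex.I * (ω : ℂ)) • vecMulVec v (star v) := by
    rw [mul_vecMulVec, hSv, smul_vecMulVec]
  have hPH : vecMulVec v (star v) * Sᴴ = -((Complex.I * (ω : ℂ)) • vecMulVec v (star v)) := by
    have := congrArg conjTranspose hP
    rw [conjTranspose_mul, conjTranspose_smul, conjTranspose_vecMulVec, star_star] at this
    rw [this]
    simp
  refine ⟨hnorm, ?_, ?_⟩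
  · calc _ = S * vecMulVec v (star v) + vecMulVec v (star v) * Sᴴ := by
          rw [hSH, hS, Finset.sum_mul, Finset.mul_sum, ← Finset.sum_add_distrib]
          simp only [Matrix.smul_mul, Matrix.mul_smul]
      _ = 0 := by rw [hP, hPH, add_neg_cancel]
  · rw [hSv, dotProduct_smul, hv, smul_eq_mul, mul_one]
end

section
/- Let z ∈ ℂ with |z| = 1 and v ∈ ℂⁿ with v^*·v = 1 satisfy Σ_{k=0}^m (z^{n_k}·A_k·(v·v^*) + z^{−n_k}·(v·v^*)·A_kᵀ) = 0, and let ω ∈ ℝ with ω ≠ 0 satisfy i·ω = v^*·(Σ_{k=0}^m z^{n_k}·A_k)·v. For any integer p set h := (−Arg z + 2·p·π)/ω, where Arg denotes the principal argument. Then (−iω·I_n + Σ_{k=0}^m A_k·e^{−i·n_k·h·ω})·v = 0; i.e., iω is a purely imaginary eigenvalue of the commensurate delay-differential equation with delay h. -/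
open Matrix Complex
open scoped ComplexConjugate

/-- If `‖v‖ = 1`, `B v v^* + v v^* B^* = 0` and `v^* B v = iω`, then `B v = iω v`. -/
theorem mulVec_eq_smul_of_mul_vecMulVec_add_eq_zero {ι : Type*} [Fintype ι]
    {B : Matrix ι ι ℂ} {v : ι → ℂ} {ω : ℝ} (hv : star v ⬝ᵥ v = 1)
    (hB : B * vecMulVec v (star v) + vecMulVec v (star v) * Bᴴ = 0)
    (hω : I * (ω : ℂ) = star v ⬝ᵥ (B *ᵥ v)) :
    B *ᵥ v = (I * (ω : ℂ)) • v := by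
  have hproj : ∀ w : ι → ℂ, vecMulVec v (star v) *ᵥ w = (star v ⬝ᵥ w) • v := by
    intro w
    rw [vecMulVec_mulVec, op_smul_eq_smul]
  have hconj : star v ⬝ᵥ (Bᴴ *ᵥ v) = -(I * (ω : ℂ)) := by
    have hadj : star v ⬝ᵥ (Bᴴ *ᵥ v) = star (star v ⬝ᵥ (B *ᵥ v)) := by
      rw [dotProduct_mulVec, ← star_mulVec, star_dotProduct]
    rw [hadj, ← hω]
    simp
  have hBv := congrArg (· *ᵥ v) hB
  simp only [add_mulVec, ← mulVec_mulVec, hproj, hv, hconj, one_smul, zero_mulVec] at hBv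
  rw [eq_neg_of_add_eq_zero_left hBv, neg_smul, neg_neg]

/-- The exponential factors at delay `h = (−Arg z + 2 p π)/ω` are powers of `z`. -/
theorem exp_neg_I_mul_delay_eq_pow {z : ℂ} (hz : ‖z‖ = 1) {ω h : ℝ} (hω : ω ≠ 0) {p : ℤ}
    (hh : h = (-(arg z) + 2 * (p : ℝ) * Real.pi) / ω) (k : ℕ) :
    exp (-(I * (k : ℂ) * (h : ℂ) * (ω : ℂ))) = z ^ k := by
  have hmul : (h : ℂ) * (ω : ℂ) = -(arg z : ℂ) + 2 * (p : ℂ) * (Real.pi : ℂ) := by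
    have : h * ω = -(arg z) + 2 * (p : ℝ) * Real.pi := by
      rw [hh, div_mul_cancel₀ _ hω]
    exact_mod_cast congrArg ofReal this
  have hexp : exp ((arg z : ℂ) * I) = z := by
    simpa [hz] using norm_mul_exp_arg_mul_I z
  have harg : -(I * (k : ℂ) * (h : ℂ) * (ω : ℂ)) =
      (k : ℂ) * ((arg z : ℂ) * I) + ((-(k * p) : ℤ) : ℂ) * (2 * Real.pi * I) := by
    push_cast
    linear_combination (-(I * (k : ℂ))) * hmul
  rw [harg, exp_add, exp_int_mul_two_pi_mul_I, mul_one, exp_nat_mul, hexp]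

/-- Converse direction of the commensurate-delay theorem: if `|z| = 1`,
`v^*v = 1`, `∑ₖ (z^{nₖ} Aₖ v v^* + z^{−nₖ} v v^* Aₖᵀ) = 0`, `ω ≠ 0` with
`iω = v^* (∑ₖ z^{nₖ} Aₖ) v`, then `h = (−Arg z + 2 p π)/ω` gives
`(−iω I + ∑ₖ Aₖ e^{−i nₖ h ω}) v = 0`. -/
theorem statement11 (n m : ℕ) (hn : 0 < n) (hm : 0 < m)
    (A : Fin (m+1) → Matrix (Fin n) (Fin n) ℝ)
    (nk : Fin (m+1) → ℕ) (hnk0 : nk 0 = 0)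
    (z : ℂ) (hz : ‖z‖ = 1)
    (v : Fin n → ℂ) (hv : star v ⬝ᵥ v = 1)
    (hquad : (∑ k : Fin (m+1),
      (z ^ (nk k) • ((A k).map Complex.ofReal * vecMulVec v (star v)) +
        z ^ (-(nk k : ℤ)) • (vecMulVec v (star v) * ((A k).map Complex.ofReal)ᵀ))) = 0)
    (ω : ℝ) (hω : ω ≠ 0)
    (homega : Complex.I * (ω : ℂ) =
      star v ⬝ᵥ ((∑ k : Fin (m+1), z ^ (nk k) • (A k).map Complex.ofReal).mulVec v))
    (p : ℤ) (h : ℝ)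
    (hh : h = (-(Complex.arg z) + 2 * (p : ℝ) * Real.pi) / ω) :
    ((-(Complex.I * (ω : ℂ))) • (1 : Matrix (Fin n) (Fin n) ℂ) +
      ∑ k : Fin (m+1), Complex.exp (-(Complex.I * (nk k : ℂ) * (h : ℂ) * (ω : ℂ))) •
        ((A k).map Complex.ofReal)).mulVec v = 0 := by
  have hstar : star z = z⁻¹ := (inv_eq_conj hz).symm
  set B : Matrix (Fin n) (Fin n) ℂ := ∑ k : Fin (m+1), z ^ (nk k) • (A k).map ofReal with hB
  have hBH : Bᴴ = ∑ k : Fin (m+1), z ^ (-(nk k : ℤ)) • ((A k).map ofReal)ᵀ := by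
    rw [hB, conjTranspose_sum]
    refine Finset.sum_congr rfl fun k _ => ?_
    rw [conjTranspose_smul, star_pow, hstar, _root_.zpow_neg, zpow_natCast, inv_pow]
    congr 1
    ext i j
    simp
  have hlyap : B * vecMulVec v (star v) + vecMulVec v (star v) * Bᴴ = 0 := by
    rw [← hquad, hBH, hB, Finset.sum_mul, Finset.mul_sum, ← Finset.sum_add_distrib]
    simp only [smul_mul_assoc, mul_smul_comm]
  simp only [exp_neg_I_mul_delay_eq_pow hz hω hh]
  rw [← hB, add_mulVec, smul_mulVec, one_mulVec,
    mulVec_eq_smul_of_mul_vecMulVec_add_eq_zero hv hlyap homega, neg_smul, neg_add_cancel]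
end

section
/- Let z ∈ ℂ with |z| = 1, let v ∈ ℂⁿ, and set x := v ⊗ conj(v); assume ‖x‖ = 1 and (z²·M + z·G + K)·x = 0. Let u ∈ ℂⁿ and q, y ∈ ℂ^{n²} be such that x + y = u ⊗ conj(u) + q. Then 1 − |u^*·v|² ≤ ‖y‖·(‖M + I‖ + ‖G‖ + ‖K‖) + ‖q‖. -/
open Matrix Complex
open scoped ComplexConjugate

/-- The inner product of `v ⊗ conj v` with `u ⊗ conj u` is `|u^* v|²`. -/
lemma sum_tensor_conj_eq_norm_sq {ι : Type*} [Fintype ι] (u v : ι → ℂ) :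
    ∑ p : ι × ι, u p.2 * conj (u p.1) * conj (v p.2 * conj (v p.1)) =
      ((‖star u ⬝ᵥ v‖ ^ 2 : ℝ) : ℂ) := by
  have h : ((‖star u ⬝ᵥ v‖ ^ 2 : ℝ) : ℂ) = (star u ⬝ᵥ v) * conj (star u ⬝ᵥ v) := by
    rw [Complex.mul_conj, Complex.normSq_eq_norm_sq]
  rw [h]
  simp only [dotProduct, map_sum, Fintype.sum_prod_type, Finset.sum_mul_sum]
  refine Finset.sum_congr rfl fun i _ => Finset.sum_congr rfl fun j _ => ?_
  simp only [Pi.star_apply, map_mul, RCLike.star_def, Complex.conj_conj]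
  ring

/-- A unit vector in the kernel of `z² M + z G + K` with `|z| = 1` forces
`1 ≤ ‖M + I‖ + ‖G‖ + ‖K‖`. -/
lemma one_le_sum_norm_of_quadratic_eigenpair {ι : Type*} [Fintype ι] [DecidableEq ι]
    (M G K : Matrix ι ι ℂ) {z : ℂ} (hz : ‖z‖ = 1) {x : EuclideanSpace ℂ ι} (hx : ‖x‖ = 1)
    (h : (z ^ 2 • M + z • G + K).mulVec (WithLp.equiv 2 _ x) = 0) :
    1 ≤ ‖Matrix.toEuclideanCLM (𝕜 := ℂ) (n := ι) (M + 1)‖ +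
      ‖Matrix.toEuclideanCLM (𝕜 := ℂ) (n := ι) G‖ +
      ‖Matrix.toEuclideanCLM (𝕜 := ℂ) (n := ι) K‖ := by
  set T := Matrix.toEuclideanCLM (𝕜 := ℂ) (n := ι) with hT
  have h0 : T (z ^ 2 • M + z • G + K) x = 0 := by
    ext i
    simpa [hT, Matrix.add_mulVec, Matrix.smul_mulVec] using congrFun h i
  have h1 : z ^ 2 • x = z ^ 2 • T (M + 1) x + z • T G x + T K x := by
    simp only [map_add, map_smul, map_one, _root_.add_apply,
      _root_.smul_apply, one_apply_eq_self] at h0 ⊢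
    rw [smul_add, ← sub_eq_zero, ← neg_eq_zero, ← h0]
    abel
  have bound (A : Matrix ι ι ℂ) : ‖T A x‖ ≤ ‖T A‖ := by
    simpa [hx] using (T A).le_opNorm x
  calc (1 : ℝ) = ‖z ^ 2 • x‖ := by simp [norm_smul, hz, hx]
    _ = ‖z ^ 2 • T (M + 1) x + z • T G x + T K x‖ := by rw [h1]
    _ ≤ ‖z ^ 2 • T (M + 1) x‖ + ‖z • T G x‖ + ‖T K x‖ := norm_add₃_le
    _ = ‖T (M + 1) x‖ + ‖T G x‖ + ‖T K x‖ := by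
      simp only [norm_smul, norm_pow, hz, one_pow, one_mul]
    _ ≤ ‖T (M + 1)‖ + ‖T G‖ + ‖T K‖ := by gcongr <;> exact bound _

/-- Lemma (accuracy of the rank-one approximation, quadratic case): if
`(z, x)` with `|z| = 1`, `x = v ⊗ conj v`, `‖x‖ = 1` is an eigenpair of
`(z² M + z G + K) x = 0`, and `x + y = u ⊗ conj u + q`, then
`1 − |u^* v|² ≤ ‖y‖ (‖M + I‖ + ‖G‖ + ‖K‖) + ‖q‖`, where the matrix norms
are the ℓ²-operator norms. -/
theorem statement14 (n : ℕ) (hn : 0 < n)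
    (M G K : Matrix (Fin n × Fin n) (Fin n × Fin n) ℂ)
    (z : ℂ) (hz : ‖z‖ = 1)
    (v : Fin n → ℂ) (x : EuclideanSpace ℂ (Fin n × Fin n))
    (hx : ∀ p : Fin n × Fin n, x p = v p.2 * conj (v p.1))
    (hxnorm : ‖x‖ = 1)
    (heig : (z ^ 2 • M + z • G + K).mulVec (WithLp.equiv 2 _ x) = 0)
    (u : Fin n → ℂ) (y q : EuclideanSpace ℂ (Fin n × Fin n))
    (hdecomp : ∀ p : Fin n × Fin n, x p + y p = u p.2 * conj (u p.1) + q p) :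
    1 - ‖star u ⬝ᵥ v‖ ^ 2 ≤
      ‖y‖ * (‖Matrix.toEuclideanCLM (𝕜 := ℂ) (n := Fin n × Fin n) (M + 1)‖ +
          ‖Matrix.toEuclideanCLM (𝕜 := ℂ) (n := Fin n × Fin n) G‖ + ‖Matrix.toEuclideanCLM (𝕜 := ℂ) (n := Fin n × Fin n) K‖) +
        ‖q‖ := by
  have hS := one_le_sum_norm_of_quadratic_eigenpair M G K hz hxnorm heig
  have hinner : inner ℂ x (x + y - q) = ((‖star u ⬝ᵥ v‖ ^ 2 : ℝ) : ℂ) := by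
    rw [← sum_tensor_conj_eq_norm_sq, PiLp.inner_apply]
    refine Finset.sum_congr rfl fun p _ => ?_
    rw [PiLp.sub_apply, PiLp.add_apply, hdecomp, add_sub_cancel_right, RCLike.inner_apply, hx]
  have hdiff : ((1 - ‖star u ⬝ᵥ v‖ ^ 2 : ℝ) : ℂ) = inner ℂ x (q - y) := by
    rw [Complex.ofReal_sub, ← hinner, inner_sub_right, inner_add_right, inner_sub_right,
      inner_self_eq_norm_sq_to_K, hxnorm]
    simp
    ring
  calc 1 - ‖star u ⬝ᵥ v‖ ^ 2 ≤ ‖((1 - ‖star u ⬝ᵥ v‖ ^ 2 : ℝ) : ℂ)‖ := by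
        rw [Complex.norm_real]
        exact Real.le_norm_self _
    _ = ‖inner ℂ x (q - y)‖ := by rw [hdiff]
    _ ≤ ‖x‖ * ‖q - y‖ := norm_inner_le_norm _ _
    _ = ‖q - y‖ := by rw [hxnorm, one_mul]
    _ ≤ ‖q‖ + ‖y‖ := norm_sub_le _ _
    _ = ‖y‖ * 1 + ‖q‖ := by ring
    _ ≤ _ := by gcongr
end

section
/- Let z ∈ ℂ with |z| = 1, let v ∈ ℂⁿ, and set x := v ⊗ conj(v); assume ‖x‖ = 1 and (z²·M + z·G + K)·x = 0. Let u ∈ ℂⁿ and q, y ∈ ℂ^{n²} be such that x + y = u ⊗ conj(u) + q. Then the exact identity |u^*·v|² = 1 + y^*·(((M + I) + z^{−1}·G + z^{−2}·K)·x) − q^*·x holds, where for vectors a, b ∈ ℂ^{n²}, a^*·b := Σ_α conj(a_α)·b_α. -/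
open Matrix Complex
open scoped ComplexConjugate

/-- `(u ⊗ conj u)^* (v ⊗ conj v) = |u^* v|²`. -/
theorem sum_star_mul_conj_mul_eq_norm_sq {ι : Type*} [Fintype ι] (u v : ι → ℂ) :
    ∑ p : ι × ι, conj (u p.2 * conj (u p.1)) * (v p.2 * conj (v p.1)) =
      (‖star u ⬝ᵥ v‖ ^ 2 : ℂ) := by
  rw [← Complex.conj_mul', dotProduct, map_sum, Finset.sum_mul_sum, Fintype.sum_prod_type]
  refine Finset.sum_congr rfl fun i _ => Finset.sum_congr rfl fun j _ => ?_
  simp only [map_mul, Complex.conj_conj, Pi.star_apply, RCLike.star_def]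
  ring

/-- Exact identity behind the accuracy lemma: if `(z, x)` with `|z| = 1`,
`x = v ⊗ conj v`, `‖x‖ = 1` is an eigenpair of `(z² M + z G + K) x = 0` and
`x + y = u ⊗ conj u + q`, then
`|u^* v|² = 1 + y^* (((M + I) + z⁻¹ G + z⁻² K) x) − q^* x`. -/
theorem statement15 (n : ℕ) (hn : 0 < n)
    (M G K : Matrix (Fin n × Fin n) (Fin n × Fin n) ℂ)
    (z : ℂ) (hz : ‖z‖ = 1)
    (v : Fin n → ℂ) (x : EuclideanSpace ℂ (Fin n × Fin n))
    (hx : ∀ p : Fin n × Fin n, x p = v p.2 * conj (v p.1))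
    (hxnorm : ‖x‖ = 1)
    (heig : (z ^ 2 • M + z • G + K).mulVec (WithLp.equiv 2 _ x) = 0)
    (u : Fin n → ℂ) (y q : EuclideanSpace ℂ (Fin n × Fin n))
    (hdecomp : ∀ p : Fin n × Fin n, x p + y p = u p.2 * conj (u p.1) + q p) :
    (‖star u ⬝ᵥ v‖ ^ 2 : ℂ) =
      1 + star (WithLp.equiv 2 _ y) ⬝ᵥ
            (((M + 1) + z⁻¹ • G + (z ^ 2)⁻¹ • K).mulVec (WithLp.equiv 2 _ x)) -
        star (WithLp.equiv 2 _ q) ⬝ᵥ (WithLp.equiv 2 _ x) := by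
  have hz0 : z ≠ 0 := by
    rintro rfl
    simp at hz
  have hmat : (M + 1) + z⁻¹ • G + (z ^ 2)⁻¹ • K = 1 + (z ^ 2)⁻¹ • (z ^ 2 • M + z • G + K) := by
    have hzz : (z ^ 2)⁻¹ * z = z⁻¹ := by field_simp
    rw [smul_add, smul_add, smul_smul, smul_smul, inv_mul_cancel₀ (pow_ne_zero 2 hz0), one_smul,
      hzz]
    abel
  have hone : ∑ p, conj (x p) * x p = 1 := by
    have h := EuclideanSpace.norm_sq_eq x
    rw [hxnorm, one_pow] at h
    simp only [Complex.conj_mul']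
    exact_mod_cast h.symm
  rw [hmat, add_mulVec, one_mulVec, smul_mulVec, heig, smul_zero, add_zero,
    ← sum_star_mul_conj_mul_eq_norm_sq, ← hone]
  simp only [dotProduct, ← Finset.sum_add_distrib, ← Finset.sum_sub_distrib]
  refine Finset.sum_congr rfl fun p _ => ?_
  rw [← hx p, eq_sub_of_add_eq (hdecomp p).symm]
  simp only [map_sub, map_add, Pi.star_apply, RCLike.star_def, WithLp.equiv_apply]
  ring
end

section
/- Fix complex n²×n² matrices B_0, …, B_N. Let z ∈ ℂ with |z| = 1, let v ∈ ℂⁿ, and set x := v ⊗ conj(v); assume ‖x‖ = 1 and (Σ_{k=0}^N z^k·B_k)·x = 0. Let u ∈ ℂⁿ and q, y ∈ ℂ^{n²} be such that x + y = u ⊗ conj(u) + q. Then 1 − |u^*·v|² ≤ ‖y‖·(1 + Σ_{k=0}^N ‖B_k‖) + ‖q‖. -/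
open Matrix Complex
open scoped ComplexConjugate

/-- The inner product of two rank-one vectors `v ⊗ conj v` and `u ⊗ conj u` is `|u^* v|²`. -/
lemma inner_kronecker_conj {ι : Type*} [Fintype ι] (u v : ι → ℂ) (x w : EuclideanSpace ℂ (ι × ι))
    (hx : ∀ p : ι × ι, x p = v p.2 * conj (v p.1))
    (hw : ∀ p : ι × ι, w p = u p.2 * conj (u p.1)) :
    inner ℂ x w = ((‖star u ⬝ᵥ v‖ ^ 2 : ℝ) : ℂ) := by
  push_cast
  rw [← Complex.mul_conj']
  simp only [PiLp.inner_apply, RCLike.inner_apply, hx, hw, dotProduct, map_sum, map_mul,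
    Pi.star_apply, RCLike.star_def, Complex.conj_conj, Fintype.sum_prod_type,
    Finset.sum_mul_sum]
  refine Finset.sum_congr rfl fun i _ => Finset.sum_congr rfl fun j _ => ?_
  ring

/-- Lemma (accuracy of the rank-one approximation, polynomial case): if
`(z, x)` with `|z| = 1`, `x = v ⊗ conj v`, `‖x‖ = 1` is an eigenpair of the
polynomial eigenvalue problem `(∑_{k=0}^N z^k Bₖ) x = 0`, and
`x + y = u ⊗ conj u + q`, then `1 − |u^* v|² ≤ ‖y‖ (1 + ∑ₖ ‖Bₖ‖) + ‖q‖`,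
where the matrix norms are the ℓ²-operator norms. -/
theorem statement16 (n N : ℕ) (hn : 0 < n) (hN : 0 < N)
    (B : Fin (N+1) → Matrix (Fin n × Fin n) (Fin n × Fin n) ℂ)
    (z : ℂ) (hz : ‖z‖ = 1)
    (v : Fin n → ℂ) (x : EuclideanSpace ℂ (Fin n × Fin n))
    (hx : ∀ p : Fin n × Fin n, x p = v p.2 * conj (v p.1))
    (hxnorm : ‖x‖ = 1)
    (heig : (∑ k : Fin (N+1), z ^ (k : ℕ) • B k).mulVec (WithLp.equiv 2 _ x) = 0)
    (u : Fin n → ℂ) (y q : EuclideanSpace ℂ (Fin n × Fin n))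
    (hdecomp : ∀ p : Fin n × Fin n, x p + y p = u p.2 * conj (u p.1) + q p) :
    1 - ‖star u ⬝ᵥ v‖ ^ 2 ≤
      ‖y‖ * (1 + ∑ k : Fin (N+1),
          ‖Matrix.toEuclideanCLM (𝕜 := ℂ) (n := Fin n × Fin n) (B k)‖) + ‖q‖ := by
  have hxw : inner ℂ x (x + y - q) = ((‖star u ⬝ᵥ v‖ ^ 2 : ℝ) : ℂ) :=
    inner_kronecker_conj u v x _ hx fun p => by simp [hdecomp p]
  have hre : 1 + (inner ℂ x y).re - (inner ℂ x q).re = ‖star u ⬝ᵥ v‖ ^ 2 := by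
    have h := congrArg Complex.re hxw
    rw [inner_sub_right, inner_add_right, inner_self_eq_norm_sq_to_K, hxnorm,
      Complex.ofReal_re] at h
    simpa using h
  have hy : -(inner ℂ x y).re ≤ ‖y‖ := by
    have h := (neg_le_abs _).trans ((Complex.abs_re_le_norm _).trans (norm_inner_le_norm x y))
    rwa [hxnorm, one_mul] at h
  have hq : (inner ℂ x q).re ≤ ‖q‖ := by
    have h := (Complex.re_le_norm _).trans (norm_inner_le_norm (𝕜 := ℂ) x q)
    rwa [hxnorm, one_mul] at h
  have hB : ‖y‖ ≤ ‖y‖ * (1 + ∑ k : Fin (N+1),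
      ‖Matrix.toEuclideanCLM (𝕜 := ℂ) (n := Fin n × Fin n) (B k)‖) :=
    le_mul_of_one_le_right (norm_nonneg y)
      (le_add_of_nonneg_right (Finset.sum_nonneg fun k _ => norm_nonneg _))
  linarith
end
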